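/- arXiv:2411.01720 — 2 statements merged into one kernel-verified Lean document; each statement's English description precedes it below -/
import Mathlib

section
/- Let G be an undirected n-node graph with adjacency matrix A ∈ {0,1}^{n×n} (where A_{ij} = 1 iff {i,j} is an edge or i = j). Let k, T ∈ ℕ with k ≥ 2T, let ℓ ∈ ℕ with k/T ≤ ℓ ≤ k (so ℓ ≥ 2), and let γ satisfy 0 < γ < 1/(40² ℓ⁴ (ℓ+1)² k²). Let x, y be probability distributions on [n] such that Σ_{i,j} x_i (A_{ij} + γ·1{i=j}) y_j ≥ 1 + γ/ℓ − 6γ²T² and such that x_i ≤ (1 + 6kγ)/ℓ and y_j ≤ (1 + 6kγ)/ℓ for all i, j ∈ [n]. Then the set S := {i ∈ [n] : x_i ≥ (1 − 40ℓ²k√γ)/ℓ} has exactly ℓ elements and induces an ℓ-clique in G (i.e., A_{ij} = 1 for all i, j ∈ S). -/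
/-- A probability distribution on a finite type. -/
def IsDist {I : Type*} [Fintype I] (x : I → ℝ) : Prop :=
  (∀ i, 0 ≤ x i) ∧ ∑ i, x i = 1

/-- `μ` is an `ε`-coarse correlated equilibrium of the game with payoff matrices `R, C`. -/
def IsCCE {I : Type*} [Fintype I] (R C : Matrix I I ℝ) (μ : I → I → ℝ) (ε : ℝ) : Prop :=
  (∀ a' : I, ∑ a, ∑ b, μ a b * R a b ≥ ∑ a, ∑ b, μ a b * R a' b - ε) ∧
  (∀ b' : I, ∑ a, ∑ b, μ a b * C a b ≥ ∑ a, ∑ b, μ a b * C a b' - ε)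

/-- The (utilitarian) social welfare of a correlated distribution `μ`. -/
def sw {I : Type*} [Fintype I] (R C : Matrix I I ℝ) (μ : I → I → ℝ) : ℝ :=
  ∑ a, ∑ b, μ a b * (R a b + C a b)

/-- The adjacency matrix of `G`, with ones on the diagonal:
`A i j = 1` iff `{i, j}` is an edge or `i = j`. -/
def adjMat (n : ℕ) (G : SimpleGraph (Fin n)) [DecidableRel G.Adj] :
    Matrix (Fin n) (Fin n) ℝ :=
  fun i j => if i = j ∨ G.Adj i j then 1 else 0

/-- The row player's payoff matrix of the game `𝒢(k, γ)`:
`R = ½ [[A + γ Iₙ, −k Iₙ], [k Iₙ, 0ₙ]]`. -/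
noncomputable def Rmat (n : ℕ) (G : SimpleGraph (Fin n)) [DecidableRel G.Adj]
    (k : ℕ) (γ : ℝ) : Matrix (Fin n ⊕ Fin n) (Fin n ⊕ Fin n) ℝ :=
  (1 / 2 : ℝ) • Matrix.fromBlocks
    (adjMat n G + γ • (1 : Matrix (Fin n) (Fin n) ℝ))
    ((-(k : ℝ)) • (1 : Matrix (Fin n) (Fin n) ℝ))
    (((k : ℝ)) • (1 : Matrix (Fin n) (Fin n) ℝ))
    (0 : Matrix (Fin n) (Fin n) ℝ)

/-- The column player's payoff matrix of the game `𝒢(k, γ)`: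
`C = ½ [[A + γ Iₙ, k Iₙ], [−k Iₙ, 0ₙ]]`. -/
noncomputable def Cmat (n : ℕ) (G : SimpleGraph (Fin n)) [DecidableRel G.Adj]
    (k : ℕ) (γ : ℝ) : Matrix (Fin n ⊕ Fin n) (Fin n ⊕ Fin n) ℝ :=
  (1 / 2 : ℝ) • Matrix.fromBlocks
    (adjMat n G + γ • (1 : Matrix (Fin n) (Fin n) ℝ))
    (((k : ℝ)) • (1 : Matrix (Fin n) (Fin n) ℝ))
    ((-(k : ℝ)) • (1 : Matrix (Fin n) (Fin n) ℝ))
    (0 : Matrix (Fin n) (Fin n) ℝ)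

set_option maxHeartbeats 4000000 in
/-- extracting an `ℓ`-clique from a near-optimal anti-concentrated product
distribution (Lemma induced-clique). -/
theorem stmt6 (n : ℕ) (G : SimpleGraph (Fin n)) [DecidableRel G.Adj]
    (k T ℓ : ℕ) (hT : 0 < T) (hkT : 2 * T ≤ k)
    (hℓlb : (k : ℝ) / (T : ℝ) ≤ (ℓ : ℝ)) (hℓub : ℓ ≤ k)
    (γ : ℝ) (hγ0 : 0 < γ)
    (hγ : γ < 1 / ((40 : ℝ) ^ 2 * (ℓ : ℝ) ^ 4 * ((ℓ : ℝ) + 1) ^ 2 * (k : ℝ) ^ 2))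
    (x y : Fin n → ℝ) (hx : IsDist x) (hy : IsDist y)
    (hxb : ∀ i, x i ≤ (1 + 6 * (k : ℝ) * γ) / (ℓ : ℝ))
    (hyb : ∀ j, y j ≤ (1 + 6 * (k : ℝ) * γ) / (ℓ : ℝ))
    (hwel : ∑ i, ∑ j, x i * (adjMat n G i j + γ * (if i = j then 1 else 0)) * y j
      ≥ 1 + γ / (ℓ : ℝ) - 6 * γ ^ 2 * (T : ℝ) ^ 2)
    (S : Set (Fin n))
    (hS : S = {i : Fin n | (1 - 40 * (ℓ : ℝ) ^ 2 * (k : ℝ) * Real.sqrt γ) / (ℓ : ℝ) ≤ x i}) :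
    S.ncard = ℓ ∧ ∀ i ∈ S, ∀ j ∈ S, adjMat n G i j = 1 := by
  obtain ⟨hx0, hx1⟩ := hx
  obtain ⟨hy0, hy1⟩ := hy
  set L : ℝ := (ℓ : ℝ) with hL
  set K : ℝ := (k : ℝ) with hK
  have hT1 : (1 : ℝ) ≤ T := by exact_mod_cast hT
  have hKT : 2 * (T : ℝ) ≤ K := by rw [hK]; exact_mod_cast hkT
  have hK2 : 2 ≤ K := by linarith
  have hL2 : 2 ≤ L := by
    refine le_trans ?_ hℓlb
    rw [le_div_iff₀ (by linarith)]; exact hKT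
  have hLpos : 0 < L := by linarith
  set s : ℝ := K * Real.sqrt γ with hs
  have hsqrt : Real.sqrt γ ^ 2 = γ := Real.sq_sqrt hγ0.le
  have hs2 : s ^ 2 = K ^ 2 * γ := by rw [hs, mul_pow, hsqrt]
  have hs0 : 0 < s := by have := Real.sqrt_pos.2 hγ0; positivity
  have hsm : 40 * L ^ 2 * (L + 1) * s < 1 := by
    have h1 : (40 * L ^ 2 * (L + 1) * s) ^ 2 < 1 := by
      rw [lt_div_iff₀ (by positivity)] at hγ
      have : (40 * L ^ 2 * (L + 1) * s) ^ 2
          = γ * ((40 : ℝ) ^ 2 * L ^ 4 * (L + 1) ^ 2 * K ^ 2) := by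
        rw [mul_pow, hs2]; ring
      rw [this]; exact hγ
    nlinarith [show 0 < 40 * L ^ 2 * (L + 1) * s by positivity]
  have hsL : L ^ 2 * s < 1 / 40 := by
    have : 0 < L ^ 2 * s := by positivity
    nlinarith
  have hsL1 : (L + 1) * s < 1 / 160 := by
    have : 0 < (L + 1) * s := by positivity
    have h4 : 4 ≤ L ^ 2 := by nlinarith
    nlinarith
  have hs480 : s < 1 / 480 := by nlinarith
  set M : ℝ := (1 + 6 * K * γ) / L with hM
  have hML : M * L = 1 + 6 * K * γ := by rw [hM]; field_simp
  have hKγ : 6 * K * γ ≤ 3 * s ^ 2 := by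
    rw [hs2]
    nlinarith [mul_nonneg (mul_nonneg (by linarith : (0:ℝ) ≤ K) hγ0.le) (by linarith : 0 ≤ K - 2)]
  have hKγ0 : 0 < 6 * K * γ := by positivity
  have hMpos : 0 < M := by rw [hM]; positivity
  have hMinv : 1 / L ≤ M := by
    rw [hM]; gcongr; linarith
  have hMinv2 : M - 1 / L = 6 * K * γ / L := by rw [hM]; ring
  have hD1 : 6 * K * γ / L + 6 * γ * (T : ℝ) ^ 2 ≤ 3 * s ^ 2 := by
    have h1 : 6 * K * γ / L ≤ 6 * K * γ / 2 := by gcongr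
    have h2 : (T : ℝ) ^ 2 ≤ K ^ 2 / 4 := by nlinarith
    have h3 := mul_le_mul_of_nonneg_left h2 hγ0.le
    rw [hs2] at hKγ ⊢
    linarith
  -- the two parts of the welfare
  set P : ℝ := ∑ i, x i * y i with hP
  set Q : ℝ := ∑ i, ∑ j, x i * (1 - adjMat n G i j) * y j with hQ
  have hsplit : ∑ i, ∑ j, x i * (adjMat n G i j + γ * (if i = j then 1 else 0)) * y j
      = 1 - Q + γ * P := by
    have h1 : ∑ i, ∑ j, x i * y j = 1 := by
      rw [← Finset.sum_mul_sum, hx1, hy1, one_mul]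
    have h2 : γ * P = ∑ i, ∑ j, (if i = j then γ * (x i * y j) else 0) := by
      simp [hP, Finset.mul_sum]
    have h3 : 1 - Q + γ * P = ∑ i, ∑ j, x i * y j - Q + γ * P := by rw [h1]
    rw [h3, h2, hQ, ← Finset.sum_sub_distrib, ← Finset.sum_add_distrib]
    refine Finset.sum_congr rfl fun i _ => ?_
    rw [← Finset.sum_sub_distrib, ← Finset.sum_add_distrib]
    refine Finset.sum_congr rfl fun j _ => ?_
    split_ifs <;> ring
  rw [hsplit] at hwel
  have hterm : ∀ i j, 0 ≤ x i * (1 - adjMat n G i j) * y j := by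
    intro i j
    have : 0 ≤ 1 - adjMat n G i j := by
      unfold adjMat; split_ifs <;> norm_num
    exact mul_nonneg (mul_nonneg (hx0 i) this) (hy0 j)
  have hQ0 : 0 ≤ Q := Finset.sum_nonneg fun i _ => Finset.sum_nonneg fun j _ => hterm i j
  have hPlow : 1 / L - 6 * γ * (T : ℝ) ^ 2 ≤ P := by
    have : γ * (1 / L - 6 * γ * (T : ℝ) ^ 2) ≤ γ * P := by
      have : γ * (1 / L - 6 * γ * (T : ℝ) ^ 2) = γ / L - 6 * γ ^ 2 * (T : ℝ) ^ 2 := by ring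
      linarith
    exact le_of_mul_le_mul_left this hγ0
  have hPM : M - 3 * s ^ 2 ≤ P := by linarith
  have hPup : P ≤ M := by
    calc P ≤ ∑ i, x i * M := Finset.sum_le_sum fun i _ => mul_le_mul_of_nonneg_left (hyb i) (hx0 i)
      _ = M := by rw [← Finset.sum_mul, hx1, one_mul]
  have hQup : Q ≤ γ * (3 * s ^ 2) := by
    have h1 : γ * P ≤ γ * M := mul_le_mul_of_nonneg_left hPup hγ0.le
    have h2 : γ * (M - 1 / L + 6 * γ * (T : ℝ) ^ 2) ≤ γ * (3 * s ^ 2) :=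
      mul_le_mul_of_nonneg_left (by linarith) hγ0.le
    have h3 : γ * (M - 1 / L + 6 * γ * (T : ℝ) ^ 2)
        = γ * M - γ / L + 6 * γ ^ 2 * (T : ℝ) ^ 2 := by ring
    linarith
  -- second moment of x
  have hxx : M - 6 * s ^ 2 ≤ ∑ i, x i ^ 2 := by
    have hcs : P ^ 2 ≤ (∑ i, x i ^ 2) * ∑ i, y i ^ 2 := Finset.sum_mul_sq_le_sq_mul_sq Finset.univ x y
    have hyy : ∑ i, y i ^ 2 ≤ M := by
      calc ∑ i, y i ^ 2 ≤ ∑ i, y i * M := Finset.sum_le_sum fun i _ => by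
            rw [sq]; exact mul_le_mul_of_nonneg_left (hyb i) (hy0 i)
        _ = M := by rw [← Finset.sum_mul, hy1, one_mul]
    have hX0 : 0 ≤ ∑ i, x i ^ 2 := Finset.sum_nonneg fun i _ => sq_nonneg _
    have h1 : P ^ 2 ≤ (∑ i, x i ^ 2) * M := hcs.trans (mul_le_mul_of_nonneg_left hyy hX0)
    have h2 : (M - 6 * s ^ 2) * M ≤ (∑ i, x i ^ 2) * M := by
      linarith [sq_nonneg (P - M), mul_le_mul_of_nonneg_right hPM hMpos.le]
    exact le_of_mul_le_mul_right h2 hMpos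
  have hxM : ∑ i, x i * (M - x i) ≤ 6 * s ^ 2 := by
    have : ∑ i, x i * (M - x i) = M - ∑ i, x i ^ 2 := by
      simp_rw [mul_sub, Finset.sum_sub_distrib, ← Finset.sum_mul, hx1, one_mul, sq]
    linarith
  set θ : ℝ := (1 - 40 * L ^ 2 * K * Real.sqrt γ) / L with hθ
  have hθL : θ * L = 1 - 40 * L ^ 2 * s := by rw [hθ, hs]; field_simp
  have hθ' : θ = 1 / L - 40 * L * s := by rw [hθ, hs]; field_simp
  have hθlow : 1 < θ * (L + 1) := by
    have : L < θ * (L + 1) * L := by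
      have : θ * (L + 1) * L = (L + 1) * (1 - 40 * L ^ 2 * s) := by rw [← hθL]; ring
      linarith
    exact lt_of_mul_lt_mul_right (by linarith : 1 * L < θ * (L + 1) * L) hLpos.le
  classical
  set F : Finset (Fin n) := Finset.univ.filter fun i => θ ≤ x i with hF
  have hSF : S = (F : Set (Fin n)) := by rw [hS, hF]; ext i; simp
  have hFc : ∑ i ∈ F, x i + ∑ i ∈ Fᶜ, x i = 1 := by rw [Finset.sum_add_sum_compl, hx1]
  have hout : ∑ i ∈ Fᶜ, x i ≤ s / 10 := by
    have h1 : ∑ i ∈ Fᶜ, x i * (40 * L * s) ≤ 6 * s ^ 2 := by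
      refine le_trans ?_ hxM
      refine le_trans (Finset.sum_le_sum (g := fun i => x i * (M - x i)) fun i hi => ?_)
        (Finset.sum_le_sum_of_subset_of_nonneg (Finset.subset_univ _) fun i _ _ =>
          mul_nonneg (hx0 i) (by linarith [hxb i]))
      have : x i < θ := by simpa [hF] using hi
      exact mul_le_mul_of_nonneg_left (by linarith) (hx0 i)
    rw [← Finset.sum_mul] at h1
    have h0 : 0 ≤ ∑ i ∈ Fᶜ, x i := Finset.sum_nonneg fun i _ => hx0 i
    have h2 : (∑ i ∈ Fᶜ, x i) * (40 * L) ≤ 6 * s := by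
      refine le_of_mul_le_mul_right ?_ hs0
      linarith
    linarith [mul_le_mul_of_nonneg_left hL2 h0]
  have hcardlow : ℓ < F.card + 1 := by
    have h1 : ∑ i ∈ F, x i ≤ F.card * M := by
      simpa using Finset.sum_le_card_nsmul F x M fun i _ => hxb i
    by_contra hcon
    have h2 : (F.card : ℝ) + 1 ≤ L := by rw [hL]; exact_mod_cast not_lt.1 hcon
    have h3 : (F.card : ℝ) * M ≤ (L - 1) * M := mul_le_mul_of_nonneg_right (by linarith) hMpos.le
    have h4 : 1 - s / 10 ≤ (L - 1) * M := by linarith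
    have h5 : (1 - s / 10) * L ≤ (L - 1) * (1 + 3 * s ^ 2) := by
      calc (1 - s / 10) * L ≤ (L - 1) * M * L := mul_le_mul_of_nonneg_right h4 hLpos.le
        _ = (L - 1) * (M * L) := by ring
        _ ≤ _ := by
          rw [hML]; exact mul_le_mul_of_nonneg_left (by linarith) (by linarith)
    have h6 : s ^ 2 ≤ s := by linarith [mul_le_mul_of_nonneg_left hs480.le hs0.le]
    linarith [mul_le_mul_of_nonneg_left h6 (by linarith : 0 ≤ L - 1)]
  have hcardup : F.card < ℓ + 1 := by
    have h1 : F.card * θ ≤ ∑ i ∈ F, x i := by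
      simpa using Finset.card_nsmul_le_sum F x θ fun i hi => by simpa [hF] using hi
    by_contra hcon
    have h2 : L + 1 ≤ (F.card : ℝ) := by rw [hL]; exact_mod_cast not_lt.1 hcon
    have hθ0 : 0 < θ := by
      by_contra hc
      linarith [mul_nonpos_of_nonpos_of_nonneg (not_lt.1 hc) (by linarith : 0 ≤ L + 1)]
    have h3 := mul_le_mul_of_nonneg_right h2 hθ0.le
    have h0 : 0 ≤ ∑ i ∈ Fᶜ, x i := Finset.sum_nonneg fun i _ => hx0 i
    linarith
  refine ⟨?_, ?_⟩
  · rw [hSF, Set.ncard_coe_finset]; omega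
  · intro i hi j hj
    by_contra hne
    have hA : adjMat n G i j = 0 := by
      unfold adjMat at hne ⊢
      split_ifs at hne ⊢ <;> simp_all
    have hxi : θ ≤ x i := by rw [hS] at hi; exact hi
    have hxj : θ ≤ x j := by rw [hS] at hj; exact hj
    have hQij : x i * y j ≤ Q := by
      calc x i * y j = x i * (1 - adjMat n G i j) * y j := by rw [hA]; ring
        _ ≤ ∑ j, x i * (1 - adjMat n G i j) * y j :=
          Finset.single_le_sum (f := fun j => x i * (1 - adjMat n G i j) * y j)
            (fun j _ => hterm i j) (Finset.mem_univ j)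
        _ ≤ Q := Finset.single_le_sum (f := fun i => ∑ j, x i * (1 - adjMat n G i j) * y j)
            (fun i _ => Finset.sum_nonneg fun j _ => hterm i j) (Finset.mem_univ i)
    have hyj : x j * (M - y j) ≤ 3 * s ^ 2 := by
      have h1 : x j * (M - y j) ≤ ∑ i, x i * (M - y i) :=
        Finset.single_le_sum (f := fun i => x i * (M - y i))
          (fun i _ => mul_nonneg (hx0 i) (by linarith [hyb i])) (Finset.mem_univ j)
      have h2 : ∑ i, x i * (M - y i) = M - P := by
        simp_rw [mul_sub, Finset.sum_sub_distrib, ← Finset.sum_mul, hx1, one_mul, hP]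
      linarith
    have hL1 : 0 < L + 1 := by linarith
    have hMy : M - y j ≤ 3 * s ^ 2 * (L + 1) := by
      have h0 : 0 ≤ M - y j := by linarith [hyb j]
      have h1 : 1 ≤ x j * (L + 1) := hθlow.le.trans (mul_le_mul_of_nonneg_right hxj hL1.le)
      have h2 := mul_le_mul_of_nonneg_right h1 h0
      have h3 := mul_le_mul_of_nonneg_right hyj hL1.le
      linarith
    have hss : 3 * s ^ 2 * (L + 1) ≤ s / 50 := by
      linarith [mul_le_mul_of_nonneg_left hsL1.le hs0.le]
    have hyL : 1 / 2 ≤ y j * L := by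
      have h1 : (M - s / 50) * L ≤ y j * L := mul_le_mul_of_nonneg_right (by linarith) hLpos.le
      have h2 : s * L ≤ (L + 1) * s := by linarith
      linarith
    have hxL : 1 ≤ x i * (L + 1) := hθlow.le.trans (mul_le_mul_of_nonneg_right hxi hL1.le)
    have h1 : 1 / 2 ≤ (x i * y j) * (L * (L + 1)) := by
      have : 1 * (1 / 2) ≤ (x i * (L + 1)) * (y j * L) :=
        mul_le_mul hxL hyL (by norm_num) (by linarith)
      linarith
    have hγ1 : γ ≤ 1 := by
      linarith [mul_le_mul_of_nonneg_right hK2 hγ0.le, mul_le_mul_of_nonneg_left hs480.le hs0.le]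
    have h2 : x i * y j ≤ 3 * s ^ 2 := by
      have := mul_le_mul_of_nonneg_right hγ1 (by positivity : 0 ≤ 3 * s ^ 2)
      linarith
    have h3 := mul_le_mul_of_nonneg_right h2 (by positivity : 0 ≤ L * (L + 1))
    have h4 : (L * s) * ((L + 1) * s) ≤ (1 / 160) * (1 / 160) :=
      mul_le_mul (by linarith) hsL1.le (by positivity) (by norm_num)
    linarith
end

section
/- Let G be an undirected n-node graph and k, T ∈ ℕ. There exists γ₀ > 0 (depending on n, k, T) such that for all γ ∈ (0, γ₀) and all ε ∈ (0, 1/2): if G does not contain a clique of size k/(8T), then the point mass on (O,O) is the unique uniform T-sparse CCE of the game G''(k,γ,ε). -/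
/-- Row payoff matrix of `𝒢''(k, γ, ε)`: add an action `O` to `𝒢(k, γ)`; both players get `ε`
under `(O, O)`; the player playing `O` alone gets `r := (1 + γT/k)/2` and the other `−r`. -/
noncomputable def Rmat2 (n : ℕ) (G : SimpleGraph (Fin n)) [DecidableRel G.Adj]
    (k T : ℕ) (γ ε : ℝ) :
    Matrix ((Fin n ⊕ Fin n) ⊕ Unit) ((Fin n ⊕ Fin n) ⊕ Unit) ℝ :=
  fun a b =>
    match a, b with
    | Sum.inl a, Sum.inl b => Rmat n G k γ a b
    | Sum.inr _, Sum.inl _ => (1 + γ * (T : ℝ) / (k : ℝ)) / 2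
    | Sum.inl _, Sum.inr _ => -((1 + γ * (T : ℝ) / (k : ℝ)) / 2)
    | Sum.inr _, Sum.inr _ => ε

/-- Column payoff matrix of `𝒢''(k, γ, ε)`. -/
noncomputable def Cmat2 (n : ℕ) (G : SimpleGraph (Fin n)) [DecidableRel G.Adj]
    (k T : ℕ) (γ ε : ℝ) :
    Matrix ((Fin n ⊕ Fin n) ⊕ Unit) ((Fin n ⊕ Fin n) ⊕ Unit) ℝ :=
  fun a b =>
    match a, b with
    | Sum.inl a, Sum.inl b => Cmat n G k γ a b
    | Sum.inr _, Sum.inl _ => -((1 + γ * (T : ℝ) / (k : ℝ)) / 2)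
    | Sum.inl _, Sum.inr _ => (1 + γ * (T : ℝ) / (k : ℝ)) / 2
    | Sum.inr _, Sum.inr _ => ε


set_option maxHeartbeats 2000000 in
open Finset in
lemma aux_key (n : ℕ) (G : SimpleGraph (Fin n)) [DecidableRel G.Adj]
    (m γ ε : ℝ) (hm : 0 < m) (hγ : 0 < γ) (h1 : γ < 1 / 64) (h2 : γ < (m / 64) ^ 2)
    (hε : 0 < ε)
    (hcl : ¬ ∃ s : Finset (Fin n), G.IsClique (s : Set (Fin n)) ∧ 1 ≤ 8 * m * s.card)
    (p p' : Fin n → ℝ) (O O' P P' : ℝ) (hp : ∀ i, 0 ≤ p i) (hp' : ∀ i, 0 ≤ p' i)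
    (hP : ∑ i, p i = P) (hP' : ∑ i, p' i = P')
    (hO : 0 ≤ O) (hO' : 0 ≤ O') (hPO : P + O ≤ 1) (hPO' : P' + O' ≤ 1)
    (hb : ∀ i, p i ≤ 9 / 4 * m) (hb' : ∀ i, p' i ≤ 9 / 4 * m)
    (hf : 0 ≤ ∑ i, ∑ j, p i * p' j * adjMat n G i j + γ * ∑ i, p i * p' i + 2 * ε * (O * O')
      - (1 + γ * m) / 2 * (2 - O - O') - ε * (O + O')) : O = 1 ∧ O' = 1 := by
  have hP0 : 0 ≤ P := hP ▸ sum_nonneg fun i _ => hp i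
  have hP0' : 0 ≤ P' := hP' ▸ sum_nonneg fun i _ => hp' i
  set D := ∑ i, p i * p' i with hD
  set E := ∑ i, ∑ j, p i * p' j * adjMat n G i j with hE
  have hPP : P * P' = ∑ i, ∑ j, p i * p' j := by
    rw [← hP, ← hP', Finset.sum_mul_sum]
  have hEle : E ≤ P * P' := by
    rw [hPP]
    refine sum_le_sum fun i _ => sum_le_sum fun j _ => ?_
    have := mul_nonneg (hp i) (hp' j)
    unfold adjMat
    split_ifs <;> linarith
  have hDle : D ≤ P * P' := by
    rw [hPP]
    refine sum_le_sum fun i _ => ?_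
    exact single_le_sum (f := fun j => p i * p' j) (fun j _ => mul_nonneg (hp i) (hp' j))
      (mem_univ i)
  have hpair : ∀ i j, ¬ (i = j ∨ G.Adj i j) → p i * p' j ≤ P * P' - E := by
    intro i j hij
    have e : P * P' - E = ∑ a, ∑ b, (p a * p' b - p a * p' b * adjMat n G a b) := by
      rw [hPP, hE]; simp only [sum_sub_distrib]
    have nn : ∀ a b, 0 ≤ p a * p' b - p a * p' b * adjMat n G a b := by
      intro a b
      have := mul_nonneg (hp a) (hp' b)
      unfold adjMat
      split_ifs <;> linarith
    rw [e]
    calc p i * p' j = p i * p' j - p i * p' j * adjMat n G i j := by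
          simp [adjMat, hij]
      _ ≤ ∑ b, (p i * p' b - p i * p' b * adjMat n G i b) :=
          single_le_sum (f := fun b => p i * p' b - p i * p' b * adjMat n G i b)
            (fun b _ => nn i b) (mem_univ j)
      _ ≤ _ := single_le_sum
            (f := fun a => ∑ b, (p a * p' b - p a * p' b * adjMat n G a b))
            (fun a _ => sum_nonneg fun b _ => nn a b) (mem_univ i)
  have hPle : P ≤ 1 := by linarith
  have hPle' : P' ≤ 1 := by linarith
  have hw0 : 0 ≤ P * P' := mul_nonneg hP0 hP0'
  have hw1 : P * P' ≤ P := by nlinarith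
  have hw2 : P * P' ≤ P' := by nlinarith
  have hOO : 0 ≤ ε * (O + O' - 2 * (O * O')) := by
    apply mul_nonneg hε.le
    nlinarith
  have hγm : 0 < γ * m := mul_pos hγ hm
  have hr : 0 ≤ (γ * m) / 2 * (2 - O - O' - 2 * (P * P')) := by
    apply mul_nonneg (by positivity); linarith
  -- main inequality
  have hmain : γ * (m * (P * P')) + (P * P' - E) + (2 - O - O' - 2 * (P * P')) / 2 ≤ γ * D := by
    nlinarith
  rcases hw0.eq_or_lt with hw | hw
  · have : γ * D ≤ 0 := by nlinarith
    have : γ * (m * (P * P')) = 0 := by rw [← hw]; ring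
    constructor <;> linarith
  exfalso
  have hPpos : 0 < P := by
    rcases hP0.eq_or_lt with h | h
    · rw [← h] at hw; simp at hw
    · exact h
  have hPpos' : 0 < P' := by
    rcases hP0'.eq_or_lt with h | h
    · rw [← h] at hw; simp at hw
    · exact h
  have hγD : γ * D ≤ γ * (P * P') := by nlinarith
  have hmw : 0 ≤ γ * (m * (P * P')) := by positivity
  have ha : P * (1 - P') ≤ P * (2 * γ * P') := by
    have : P * (2 * γ * P') = 2 * (γ * (P * P')) := by ring
    rw [this]; linarith
  have hb1 : P' * (1 - P) ≤ P' * (2 * γ * P) := by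
    have : P' * (2 * γ * P) = 2 * (γ * (P * P')) := by ring
    rw [this]; linarith
  have ha2 : 1 - P' ≤ 2 * γ * P' := le_of_mul_le_mul_left ha hPpos
  have hb2 : 1 - P ≤ 2 * γ * P := le_of_mul_le_mul_left hb1 hPpos'
  have ha3 : 31 / 32 ≤ P' := by nlinarith
  have hb3 : 31 / 32 ≤ P := by nlinarith
  have hwl : 15 / 16 ≤ P * P' := by
    have : (31 / 32 : ℝ) * (31 / 32) ≤ P * P' := mul_le_mul hb3 ha3 (by norm_num) hP0
    linarith
  have hDl : 15 / 16 * m ≤ D := by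
    have : γ * (m * (P * P')) ≤ γ * D := by linarith
    have := le_of_mul_le_mul_left this hγ
    nlinarith
  have hnon : P * P' - E ≤ γ := by
    have : γ * (P * P') ≤ γ * 1 := mul_le_mul_of_nonneg_left (by linarith) hγ.le
    linarith
  set S : Finset (Fin n) := univ.filter fun i => m / 64 < p i ∧ m / 64 < p' i with hS
  apply hcl
  refine ⟨S, ?_, ?_⟩
  · intro i hi j hj hij
    by_contra hadj
    simp only [hS, coe_filter, mem_univ, true_and, Set.mem_ofPred_eq] at hi hj
    have := hpair i j (by tauto)
    have : (m / 64) ^ 2 ≤ p i * p' j := by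
      rw [sq]; exact mul_le_mul hi.1.le hj.2.le (by positivity) (hp i)
    linarith
  · have hterm : ∀ i, p i * p' i ≤ (if i ∈ S then (9 / 4 * m) ^ 2 else 0)
        + m / 64 * (p i + p' i) := by
      intro i
      have h3 := hp i
      have h4 := hp' i
      have h5 : 0 ≤ m / 64 * (p i + p' i) := by positivity
      split_ifs with hi
      · have : p i * p' i ≤ (9 / 4 * m) * (9 / 4 * m) :=
          mul_le_mul (hb i) (hb' i) h4 (by positivity)
        nlinarith
      · simp only [hS, mem_filter, mem_univ, true_and, not_and_or, not_lt] at hi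
        rcases hi with hi | hi <;> nlinarith
    have hsum : D ≤ S.card * (9 / 4 * m) ^ 2 + m / 64 * (P + P') := by
      calc D ≤ ∑ i, ((if i ∈ S then (9 / 4 * m) ^ 2 else 0) + m / 64 * (p i + p' i)) :=
            sum_le_sum fun i _ => hterm i
        _ = _ := by
            rw [sum_add_distrib, ← mul_sum, sum_add_distrib, hP, hP', ← sum_filter]
            simp
    have h6 : m * (29 / 32) ≤ m * ((S.card : ℝ) * m * (81 / 16)) := by nlinarith
    have := le_of_mul_le_mul_left h6 hm
    linarith

open Finset in
lemma aux_welfare (n k T : ℕ) (G : SimpleGraph (Fin n)) [DecidableRel G.Adj] (γ ε : ℝ)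
    (x y : ((Fin n ⊕ Fin n) ⊕ Unit) → ℝ) :
    ∑ a, ∑ b, x a * y b * Rmat2 n G k T γ ε a b + ∑ a, ∑ b, x a * y b * Cmat2 n G k T γ ε a b
    = ∑ i, ∑ j, x (.inl (.inl i)) * y (.inl (.inl j)) * adjMat n G i j
      + γ * ∑ i, x (.inl (.inl i)) * y (.inl (.inl i))
      + 2 * ε * (x (.inr ()) * y (.inr ())) := by
  have h : ∀ a b, x a * y b * Rmat2 n G k T γ ε a b + x a * y b * Cmat2 n G k T γ ε a b
      = match a, b with
        | .inl (.inl i), .inl (.inl j) => x (.inl (.inl i)) * y (.inl (.inl j)) * adjMat n G i j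
            + (if i = j then γ * (x (.inl (.inl i)) * y (.inl (.inl j))) else 0)
        | .inr _, .inr _ => 2 * ε * (x (.inr ()) * y (.inr ()))
        | _, _ => 0 := by
    rintro ((i | i) | u) ((j | j) | v) <;>
      simp [Rmat2, Cmat2, Rmat, Cmat, Matrix.one_apply]
    · split_ifs <;> ring
    all_goals ring
  simp only [← sum_add_distrib, h]
  simp [Fintype.sum_sum_type, sum_add_distrib, mul_sum]

open Finset in
lemma aux_devR (n k T : ℕ) (G : SimpleGraph (Fin n)) [DecidableRel G.Adj] (γ ε : ℝ)
    (x y : ((Fin n ⊕ Fin n) ⊕ Unit) → ℝ) (hx : IsDist x) (hy : IsDist y) :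
    ∑ a, ∑ b, x a * y b * Rmat2 n G k T γ ε (.inr ()) b
      = (1 + γ * (T : ℝ) / (k : ℝ)) / 2 * (1 - y (.inr ())) + ε * y (.inr ()) := by
  have : ∑ a, ∑ b, x a * y b * Rmat2 n G k T γ ε (.inr ()) b
      = (∑ a, x a) * ∑ b, y b * Rmat2 n G k T γ ε (.inr ()) b := by
    rw [sum_mul_sum]; simp only [mul_assoc]
  have h1 := hy.2
  rw [this, hx.2, one_mul]
  simp only [Fintype.sum_sum_type, Rmat2, ← sum_mul, univ_unique, sum_singleton] at h1 ⊢
  have e : y (.inr default) = y (.inr ()) := rfl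
  rw [e] at h1 ⊢
  rw [← h1]
  ring

open Finset in
lemma aux_devR2 (n k T : ℕ) (G : SimpleGraph (Fin n)) [DecidableRel G.Adj] (γ ε : ℝ)
    (x y : ((Fin n ⊕ Fin n) ⊕ Unit) → ℝ) (hx : IsDist x) (i : Fin n) :
    ∑ a, ∑ b, x a * y b * Rmat2 n G k T γ ε (.inl (.inr i)) b
      = (k : ℝ) / 2 * y (.inl (.inl i)) - (1 + γ * (T : ℝ) / (k : ℝ)) / 2 * y (.inr ()) := by
  have : ∑ a, ∑ b, x a * y b * Rmat2 n G k T γ ε (.inl (.inr i)) b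
      = (∑ a, x a) * ∑ b, y b * Rmat2 n G k T γ ε (.inl (.inr i)) b := by
    rw [sum_mul_sum]; simp only [mul_assoc]
  rw [this, hx.2]
  simp [Fintype.sum_sum_type, Rmat2, Rmat, Matrix.one_apply]
  ring

/-- The column matrix is the transpose of the row matrix. -/
lemma aux_transpose (n k T : ℕ) (G : SimpleGraph (Fin n)) [DecidableRel G.Adj] (γ ε : ℝ)
    (a b : (Fin n ⊕ Fin n) ⊕ Unit) :
    Cmat2 n G k T γ ε a b = Rmat2 n G k T γ ε b a := by
  rcases a with ((i | i) | u) <;> rcases b with ((j | j) | v) <;>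
    simp [Rmat2, Cmat2, Rmat, Cmat, Matrix.one_apply, adjMat, eq_comm, G.adj_comm]

lemma aux_swap {I : Type*} [Fintype I] (R : Matrix I I ℝ) (T : ℕ) (x y : Fin T → I → ℝ) :
    ∑ a, ∑ b, (1 / (T : ℝ)) * (∑ t, x t a * y t b) * R a b
      = (1 / (T : ℝ)) * ∑ t, ∑ a, ∑ b, x t a * y t b * R a b := by
  rw [Finset.sum_comm (s := (Finset.univ : Finset (Fin T)))]
  rw [Finset.mul_sum]
  refine Finset.sum_congr rfl fun a _ => ?_
  rw [Finset.sum_comm, Finset.mul_sum]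
  refine Finset.sum_congr rfl fun b _ => ?_
  rw [mul_assoc, Finset.sum_mul]

/-- Per-round bound on the gain. -/
lemma aux_bound (γ ε r O O' P P' E D : ℝ) (hγ : 0 < γ) (h1 : γ < 1 / 64) (hε : 0 < ε)
    (hε2 : ε < 1 / 2) (hr : 1 / 2 ≤ r) (hr2 : r ≤ 5 / 8)
    (hO : 0 ≤ O) (hO' : 0 ≤ O') (hP : 0 ≤ P) (hP' : 0 ≤ P') (hPO : P + O ≤ 1)
    (hPO' : P' + O' ≤ 1) (hE : E ≤ P * P') (hD : D ≤ P * P') :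
    E + γ * D + 2 * ε * (O * O') - (r * (1 - O) + ε * O) + r * O' ≤ 9 / 8 := by
  have hw1 : P * P' ≤ P := by nlinarith
  have hw2 : P * P' ≤ P' := by nlinarith
  have hw0 : 0 ≤ P * P' := mul_nonneg hP hP'
  have h3 : γ * D ≤ γ * (P * P') := by nlinarith
  have h4 : γ * (P * P') ≤ 1 / 64 * (P * P') := by nlinarith
  have h5 : P * P' * (1 / 2) ≤ r * (1 - O) := by nlinarith
  have h6 : O * O' ≤ O' := by nlinarith
  have h6' : O * O' ≤ O := by nlinarith
  have h7 : ε * (O * O') ≤ ε * O' := by nlinarith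
  have h7' : ε * (O * O') ≤ ε * O := by nlinarith
  have h8 : ε * O' ≤ 1 / 2 * O' := by nlinarith
  have h9 : r * O' ≤ 5 / 8 * O' := by nlinarith
  linarith

/-- for sufficiently small `γ`, if `G` has no clique of size `k/(8T)` then the
point mass on `(O, O)` is the unique uniform `T`-sparse CCE of `𝒢''(k, γ, ε)`. -/
theorem stmt13 (n k T : ℕ) (hk : 0 < k) (hT : 0 < T)
    (G : SimpleGraph (Fin n)) [DecidableRel G.Adj] :
    ∃ γ₀ : ℝ, 0 < γ₀ ∧ ∀ γ : ℝ, 0 < γ → γ < γ₀ → ∀ ε : ℝ, 0 < ε → ε < 1 / 2 →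
      (¬ ∃ s : Finset (Fin n), G.IsClique (s : Set (Fin n)) ∧
        (k : ℝ) / (8 * (T : ℝ)) ≤ s.card) →
      -- the point mass on (O, O) is a uniform T-sparse CCE ...
      ((∃ x y : Fin T → ((Fin n ⊕ Fin n) ⊕ Unit) → ℝ,
        (∀ t, IsDist (x t)) ∧ (∀ t, IsDist (y t)) ∧
        (∀ a b, (if a = Sum.inr () ∧ b = Sum.inr () then (1 : ℝ) else 0)
          = (1 / (T : ℝ)) * ∑ t, x t a * y t b) ∧
        IsCCE (Rmat2 n G k T γ ε) (Cmat2 n G k T γ ε)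
          (fun a b => if a = Sum.inr () ∧ b = Sum.inr () then (1 : ℝ) else 0) 0) ∧
      -- ... and every uniform T-sparse CCE equals the point mass on (O, O)
      (∀ x y : Fin T → ((Fin n ⊕ Fin n) ⊕ Unit) → ℝ,
        (∀ t, IsDist (x t)) → (∀ t, IsDist (y t)) →
        IsCCE (Rmat2 n G k T γ ε) (Cmat2 n G k T γ ε)
          (fun a b => (1 / (T : ℝ)) * ∑ t, x t a * y t b) 0 →
        ∀ a b, (1 / (T : ℝ)) * ∑ t, x t a * y t b
          = (if a = Sum.inr () ∧ b = Sum.inr () then (1 : ℝ) else 0))) := by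
  set m : ℝ := (T : ℝ) / k with hm
  have hk' : (0 : ℝ) < k := by exact_mod_cast hk
  have hT' : (0 : ℝ) < T := by exact_mod_cast hT
  have hm0 : 0 < m := by positivity
  refine ⟨min (1 / 64) (min ((m / 64) ^ 2) (1 / (4 * m))), by positivity, ?_⟩
  intro γ hγ hγ0 ε hε hε2 hcl
  obtain ⟨h1, h2, h3⟩ : γ < 1 / 64 ∧ γ < (m / 64) ^ 2 ∧ γ < 1 / (4 * m) := by
    simpa only [lt_min_iff] using hγ0
  have hγm : γ * m < 1 / 4 := by
    rw [lt_div_iff₀ (by positivity)] at h3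
    linarith
  have hγm0 : 0 < γ * m := by positivity
  have hrm : γ * (T : ℝ) / (k : ℝ) = γ * m := by rw [hm]; ring
  have hcl' : ¬ ∃ s : Finset (Fin n), G.IsClique (s : Set (Fin n)) ∧ 1 ≤ 8 * m * s.card := by
    rintro ⟨s, hs, hc⟩
    refine hcl ⟨s, hs, ?_⟩
    rw [div_le_iff₀ (by positivity)]
    have : k * (8 * m * s.card) = (s.card : ℝ) * (8 * T) := by
      rw [hm]; field_simp
    nlinarith
  constructor
  · refine ⟨fun _ a => if a = Sum.inr () then 1 else 0, fun _ a => if a = Sum.inr () then 1 else 0,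
      ?_, ?_, ?_, ?_⟩
    · intro t
      refine ⟨fun i => ?_, by simp⟩
      dsimp only
      split_ifs <;> norm_num
    · intro t
      refine ⟨fun i => ?_, by simp⟩
      dsimp only
      split_ifs <;> norm_num
    · intro a b
      rw [Finset.sum_const, Finset.card_univ, Fintype.card_fin, nsmul_eq_mul]
      by_cases ha : a = Sum.inr () <;> by_cases hb : b = Sum.inr () <;> simp [ha, hb, hT.ne']
    · constructor
      · rintro (a | a)
        · simp [Fintype.sum_sum_type, Rmat2, hrm]
          linarith
        · simp [Fintype.sum_sum_type, Rmat2]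
      · rintro (a | a)
        · simp [Fintype.sum_sum_type, Cmat2, hrm]
          linarith
        · simp [Fintype.sum_sum_type, Cmat2]
  intro x y hx hy hC
  have hTi : (0 : ℝ) < 1 / T := by positivity
  -- reduce to sums over rounds
  have hR : ∀ a', ∑ t, ∑ a, ∑ b, x t a * y t b * Rmat2 n G k T γ ε a' b
      ≤ ∑ t, ∑ a, ∑ b, x t a * y t b * Rmat2 n G k T γ ε a b := by
    intro a'
    have h := hC.1 a'
    have e1 := aux_swap (Rmat2 n G k T γ ε) T x y
    have e2 := aux_swap (fun _ b => Rmat2 n G k T γ ε a' b) T x y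
    rw [e1, e2] at h
    exact le_of_mul_le_mul_left (by linarith) hTi
  have hCc : ∀ b', ∑ t, ∑ a, ∑ b, x t a * y t b * Cmat2 n G k T γ ε a b'
      ≤ ∑ t, ∑ a, ∑ b, x t a * y t b * Cmat2 n G k T γ ε a b := by
    intro b'
    have h := hC.2 b'
    have e1 := aux_swap (Cmat2 n G k T γ ε) T x y
    have e2 := aux_swap (fun a _ => Cmat2 n G k T γ ε a b') T x y
    rw [e1, e2] at h
    exact le_of_mul_le_mul_left (by linarith) hTi
  have hdevC : ∀ t b', ∑ a, ∑ b, x t a * y t b * Cmat2 n G k T γ ε a b'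
      = ∑ b, ∑ a, y t b * x t a * Rmat2 n G k T γ ε b' a := by
    intro t b'
    rw [Finset.sum_comm]
    simp only [aux_transpose, mul_comm (x t _) (y t _)]
  have hR1 := hR (.inr ())
  have hC1 := hCc (.inr ())
  have hR2 := fun i => hR (.inl (.inr i))
  have hC2 := fun i => hCc (.inl (.inr i))
  simp only [hdevC] at hC1 hC2
  simp only [aux_devR n k T G γ ε _ _ (hx _) (hy _), hrm] at hR1
  simp only [aux_devR n k T G γ ε _ _ (hy _) (hx _), hrm] at hC1
  simp only [aux_devR2 n k T G γ ε _ _ (hx _), hrm] at hR2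
  simp only [aux_devR2 n k T G γ ε _ _ (hy _), hrm] at hC2
  have hW := fun t => aux_welfare n k T G γ ε (x t) (y t)
  set r : ℝ := (1 + γ * m) / 2 with hr
  set p : Fin T → Fin n → ℝ := fun t i => x t (.inl (.inl i)) with hp
  set p' : Fin T → Fin n → ℝ := fun t i => y t (.inl (.inl i)) with hp'
  set O : Fin T → ℝ := fun t => x t (.inr ()) with hO
  set O' : Fin T → ℝ := fun t => y t (.inr ()) with hO'
  set ER : Fin T → ℝ := fun t => ∑ a, ∑ b, x t a * y t b * Rmat2 n G k T γ ε a b with hER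
  set EC : Fin T → ℝ := fun t => ∑ a, ∑ b, x t a * y t b * Cmat2 n G k T γ ε a b with hEC
  have hW' : ∀ t, ER t + EC t = ∑ i, ∑ j, p t i * p' t j * adjMat n G i j
      + γ * ∑ i, p t i * p' t i + 2 * ε * (O t * O' t) := hW
  have hR1' : ∑ t, (r * (1 - O' t) + ε * O' t) ≤ ∑ t, ER t := hR1
  have hC1' : ∑ t, (r * (1 - O t) + ε * O t) ≤ ∑ t, EC t := hC1
  have hR2' : ∀ i, ∑ t, ((k : ℝ) / 2 * p' t i - r * O' t) ≤ ∑ t, ER t := hR2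
  have hC2' : ∀ i, ∑ t, ((k : ℝ) / 2 * p t i - r * O t) ≤ ∑ t, EC t := hC2
  have hpn : ∀ t i, 0 ≤ p t i := fun t i => (hx t).1 _
  have hpn' : ∀ t i, 0 ≤ p' t i := fun t i => (hy t).1 _
  have hOn : ∀ t, 0 ≤ O t := fun t => (hx t).1 _
  have hOn' : ∀ t, 0 ≤ O' t := fun t => (hy t).1 _
  have hmass : ∀ z : ((Fin n ⊕ Fin n) ⊕ Unit) → ℝ, IsDist z →
      ∑ i, z (.inl (.inl i)) + z (.inr ()) ≤ 1 := by
    intro z hz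
    have h := hz.2
    simp only [Fintype.sum_sum_type, Finset.univ_unique, Finset.sum_singleton] at h
    have : 0 ≤ ∑ i, z (.inl (.inr i)) := Finset.sum_nonneg fun i _ => hz.1 _
    have e : z (.inr default) = z (.inr ()) := rfl
    linarith
  have hPO : ∀ t, ∑ i, p t i + O t ≤ 1 := fun t => hmass _ (hx t)
  have hPO' : ∀ t, ∑ i, p' t i + O' t ≤ 1 := fun t => hmass _ (hy t)
  have hPn : ∀ t, 0 ≤ ∑ i, p t i := fun t => Finset.sum_nonneg fun i _ => hpn t i
  have hPn' : ∀ t, 0 ≤ ∑ i, p' t i := fun t => Finset.sum_nonneg fun i _ => hpn' t i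
  have hEle : ∀ t, ∑ i, ∑ j, p t i * p' t j * adjMat n G i j
      ≤ (∑ i, p t i) * ∑ i, p' t i := by
    intro t
    rw [Finset.sum_mul_sum]
    refine Finset.sum_le_sum fun i _ => Finset.sum_le_sum fun j _ => ?_
    have := mul_nonneg (hpn t i) (hpn' t j)
    unfold adjMat
    split_ifs <;> linarith
  have hDle : ∀ t, ∑ i, p t i * p' t i ≤ (∑ i, p t i) * ∑ i, p' t i := by
    intro t
    rw [Finset.sum_mul_sum]
    refine Finset.sum_le_sum fun i _ => ?_
    exact Finset.single_le_sum (f := fun j => p t i * p' t j)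
      (fun j _ => mul_nonneg (hpn t i) (hpn' t j)) (Finset.mem_univ i)
  have hr1 : 1 / 2 ≤ r := by rw [hr]; linarith
  have hr2 : r ≤ 5 / 8 := by rw [hr]; linarith
  have hfin : ∀ q : Fin T → Fin n → ℝ, (∀ t i, 0 ≤ q t i) →
      (∀ i, ∑ t, (k : ℝ) / 2 * q t i ≤ ∑ t : Fin T, (9 / 8 : ℝ)) →
      ∀ t i, q t i ≤ 9 / 4 * m := by
    intro q hq h t i
    have h4 := h i
    rw [← Finset.mul_sum, Finset.sum_const, Finset.card_univ, Fintype.card_fin,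
      nsmul_eq_mul] at h4
    have h5 : q t i ≤ ∑ t, q t i :=
      Finset.single_le_sum (f := fun t => q t i) (fun t _ => hq t i) (Finset.mem_univ t)
    have h6 : (k : ℝ) * (9 / 4 * m) = 9 / 4 * T := by rw [hm]; field_simp
    refine le_of_mul_le_mul_left ?_ hk'
    nlinarith
  have hb' : ∀ t i, p' t i ≤ 9 / 4 * m := by
    refine hfin p' hpn' fun i => ?_
    have h4 := hR2' i
    have h5 : ∑ t, (ER t + EC t - (r * (1 - O t) + ε * O t) + r * O' t)
        ≤ ∑ t : Fin T, (9 / 8 : ℝ) := by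
      refine Finset.sum_le_sum fun t _ => ?_
      rw [hW' t]
      exact aux_bound γ ε r (O t) (O' t) _ _ _ _ hγ h1 hε hε2 hr1 hr2 (hOn t) (hOn' t)
        (hPn t) (hPn' t) (hPO t) (hPO' t) (hEle t) (hDle t)
    rw [Finset.sum_sub_distrib] at h4
    rw [Finset.sum_add_distrib, Finset.sum_sub_distrib, Finset.sum_add_distrib] at h5
    linarith
  have hb : ∀ t i, p t i ≤ 9 / 4 * m := by
    refine hfin p hpn fun i => ?_
    have h4 := hC2' i
    have h5 : ∑ t, (ER t + EC t - (r * (1 - O' t) + ε * O' t) + r * O t)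
        ≤ ∑ t : Fin T, (9 / 8 : ℝ) := by
      refine Finset.sum_le_sum fun t _ => ?_
      rw [hW' t, mul_comm (O t) (O' t)]
      exact aux_bound γ ε r (O' t) (O t) (∑ i, p' t i) (∑ i, p t i) _ _ hγ h1 hε hε2 hr1 hr2
        (hOn' t) (hOn t) (hPn' t) (hPn t) (hPO' t) (hPO t)
        (by rw [mul_comm]; exact hEle t) (by rw [mul_comm]; exact hDle t)
    rw [Finset.sum_sub_distrib] at h4
    rw [Finset.sum_add_distrib, Finset.sum_sub_distrib, Finset.sum_add_distrib] at h5
    linarith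
  set f : Fin T → ℝ := fun t => ∑ i, ∑ j, p t i * p' t j * adjMat n G i j
    + γ * ∑ i, p t i * p' t i + 2 * ε * (O t * O' t)
    - (1 + γ * m) / 2 * (2 - O t - O' t) - ε * (O t + O' t) with hf
  have hkey : ∀ t, 0 ≤ f t → O t = 1 ∧ O' t = 1 := fun t ht =>
    aux_key n G m γ ε hm0 hγ h1 h2 hε hcl' (p t) (p' t) (O t) (O' t) _ _ (hpn t) (hpn' t)
      rfl rfl (hOn t) (hOn' t) (hPO t) (hPO' t) (hb t) (hb' t) ht
  have hfle : ∀ t, f t ≤ 0 := by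
    intro t
    rcases le_or_gt 0 (f t) with ht | ht
    · obtain ⟨ho, ho'⟩ := hkey t ht
      have hz : ∑ i, p t i = 0 := le_antisymm (by linarith [hPO t]) (hPn t)
      have hE := hEle t
      have hD := hDle t
      rw [hz, zero_mul] at hE hD
      simp only [hf, ho, ho']
      nlinarith
    · exact ht.le
  have hfsum : 0 ≤ ∑ t, f t := by
    have : ∑ t, f t = (∑ t, ER t + ∑ t, EC t) - (∑ t, (r * (1 - O t) + ε * O t)
        + ∑ t, (r * (1 - O' t) + ε * O' t)) := by
      rw [← Finset.sum_add_distrib, ← Finset.sum_add_distrib, ← Finset.sum_sub_distrib]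
      refine Finset.sum_congr rfl fun t _ => ?_
      rw [hW' t]
      simp only [hf, hr]
      ring
    linarith
  have hf0 : ∀ t, 0 ≤ f t := by
    intro t
    by_contra hlt
    push Not at hlt
    have : ∑ t, f t < ∑ t : Fin T, (0 : ℝ) :=
      Finset.sum_lt_sum (fun t _ => hfle t) ⟨t, Finset.mem_univ t, hlt⟩
    simp at this
    linarith
  have hpoint : ∀ z : ((Fin n ⊕ Fin n) ⊕ Unit) → ℝ, IsDist z → z (.inr ()) = 1 →
      ∀ a, z a = if a = Sum.inr () then 1 else 0 := by
    intro z hz h a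
    split_ifs with ha
    · rw [ha, h]
    · have h4 : ∑ b ∈ {a, Sum.inr ()}, z b ≤ ∑ b, z b :=
        Finset.sum_le_sum_of_subset_of_nonneg (Finset.subset_univ _) fun b _ _ => hz.1 b
      rw [Finset.sum_pair ha, hz.2, h] at h4
      exact le_antisymm (by linarith) (hz.1 a)
  intro a b
  have hterm : ∀ t, x t a * y t b = if a = Sum.inr () ∧ b = Sum.inr () then (1 : ℝ) else 0 := by
    intro t
    rw [hpoint _ (hx t) (hkey t (hf0 t)).1, hpoint _ (hy t) (hkey t (hf0 t)).2]
    by_cases ha : a = Sum.inr () <;> by_cases hb : b = Sum.inr () <;> simp [ha, hb]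
  rw [Finset.sum_congr rfl fun t _ => hterm t, Finset.sum_const, Finset.card_univ,
    Fintype.card_fin, nsmul_eq_mul, ← mul_assoc, one_div, inv_mul_cancel₀ hT'.ne', one_mul]
end
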